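/- arXiv:2206.04456 — 6 statements merged into one kernel-verified Lean document; each statement's English description precedes it below -/
import Mathlib

section
/- Let V be a symmetric positive definite d×d real matrix, let μ, y ∈ ℝ^d with y ≠ 0, and let x ∈ ℝ. Then inf{ (μ−λ)ᵀV(μ−λ) : λ ∈ ℝ^d, ⟨λ, y⟩ ≥ x } = (max(0, x − ⟨μ, y⟩))² / (yᵀV⁻¹y). Moreover the infimum is attained: at λ = μ if x − ⟨μ, y⟩ ≤ 0, and at λ = μ + ((x − ⟨μ, y⟩)/(yᵀV⁻¹y))·V⁻¹y otherwise. -/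
open Matrix

/-- For a symmetric positive definite matrix `V`, `y ≠ 0` and `x : ℝ`,
the infimum of `(μ-λ)ᵀV(μ-λ)` over `{λ | ⟨λ,y⟩ ≥ x}` equals
`(max 0 (x - ⟨μ,y⟩))² / (yᵀV⁻¹y)`, and it is attained at `λ = μ` if `x - ⟨μ,y⟩ ≤ 0`,
and at `λ = μ + ((x - ⟨μ,y⟩)/(yᵀV⁻¹y)) • V⁻¹y` otherwise. -/
theorem stmt0 {d : ℕ} (V : Matrix (Fin d) (Fin d) ℝ) (hV : V.PosDef)
    (μ y : Fin d → ℝ) (hy : y ≠ 0) (x : ℝ) :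
    IsLeast ((fun lam => (μ - lam) ⬝ᵥ V.mulVec (μ - lam)) '' {lam | x ≤ lam ⬝ᵥ y})
      ((max 0 (x - μ ⬝ᵥ y)) ^ 2 / (y ⬝ᵥ V⁻¹.mulVec y)) ∧
    (x - μ ⬝ᵥ y ≤ 0 →
      x ≤ μ ⬝ᵥ y ∧
      (μ - μ) ⬝ᵥ V.mulVec (μ - μ)
        = (max 0 (x - μ ⬝ᵥ y)) ^ 2 / (y ⬝ᵥ V⁻¹.mulVec y)) ∧
    (0 < x - μ ⬝ᵥ y →
      x ≤ (μ + ((x - μ ⬝ᵥ y) / (y ⬝ᵥ V⁻¹.mulVec y)) • V⁻¹.mulVec y) ⬝ᵥ y ∧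
      (μ - (μ + ((x - μ ⬝ᵥ y) / (y ⬝ᵥ V⁻¹.mulVec y)) • V⁻¹.mulVec y)) ⬝ᵥ
          V.mulVec (μ - (μ + ((x - μ ⬝ᵥ y) / (y ⬝ᵥ V⁻¹.mulVec y)) • V⁻¹.mulVec y))
        = (max 0 (x - μ ⬝ᵥ y)) ^ 2 / (y ⬝ᵥ V⁻¹.mulVec y)) := by
  have hdet : IsUnit V.det := hV.det_pos.ne'.isUnit
  have hq : 0 < y ⬝ᵥ V⁻¹.mulVec y := by
    have h := hV.inv.dotProduct_mulVec_pos hy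
    simpa using h
  have hVz : V.mulVec (V⁻¹.mulVec y) = y := by
    rw [Matrix.mulVec_mulVec, Matrix.mul_nonsing_inv _ hdet, Matrix.one_mulVec]
  generalize V⁻¹.mulVec y = z at *
  have hsymm : ∀ w : Fin d → ℝ, z ⬝ᵥ V.mulVec w = w ⬝ᵥ y := by
    intro w
    have hT : Vᵀ = V := by
      have h := hV.isHermitian.eq
      rwa [Matrix.conjTranspose_eq_transpose_of_trivial] at h
    rw [Matrix.dotProduct_mulVec, ← Matrix.mulVec_transpose, hT, hVz, dotProduct_comm]
  have hnn : ∀ w : Fin d → ℝ, 0 ≤ w ⬝ᵥ V.mulVec w := by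
    intro w
    have h := hV.posSemidef.dotProduct_mulVec_nonneg w
    simpa using h
  have hzy : z ⬝ᵥ y = y ⬝ᵥ z := dotProduct_comm _ _
  have h1 : x - μ ⬝ᵥ y ≤ 0 →
      x ≤ μ ⬝ᵥ y ∧
      (μ - μ) ⬝ᵥ V.mulVec (μ - μ)
        = (max 0 (x - μ ⬝ᵥ y)) ^ 2 / (y ⬝ᵥ z) := by
    intro h
    refine ⟨by linarith, ?_⟩
    rw [max_eq_left h]
    simp
  have h2 : 0 < x - μ ⬝ᵥ y →
      x ≤ (μ + ((x - μ ⬝ᵥ y) / (y ⬝ᵥ z)) • z) ⬝ᵥ y ∧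
      (μ - (μ + ((x - μ ⬝ᵥ y) / (y ⬝ᵥ z)) • z)) ⬝ᵥ
          V.mulVec (μ - (μ + ((x - μ ⬝ᵥ y) / (y ⬝ᵥ z)) • z))
        = (max 0 (x - μ ⬝ᵥ y)) ^ 2 / (y ⬝ᵥ z) := by
    intro h
    constructor
    · rw [add_dotProduct, smul_dotProduct, hzy, smul_eq_mul, div_mul_cancel₀ _ hq.ne']
      linarith
    · rw [max_eq_right h.le, sub_add_cancel_left, Matrix.mulVec_neg, neg_dotProduct,
        dotProduct_neg, neg_neg, Matrix.mulVec_smul, hVz, smul_dotProduct, dotProduct_smul, hzy,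
        smul_eq_mul, smul_eq_mul]
      field_simp
  refine ⟨⟨?_, ?_⟩, h1, h2⟩
  · rcases le_or_gt (x - μ ⬝ᵥ y) 0 with h | h
    · exact ⟨μ, h1 h⟩
    · exact ⟨_, h2 h⟩
  · rintro _ ⟨lam, hl, rfl⟩
    have hl' : x ≤ lam ⬝ᵥ y := hl
    show _ ≤ (μ - lam) ⬝ᵥ V.mulVec (μ - lam)
    have hw : (μ - lam) ⬝ᵥ y = μ ⬝ᵥ y - lam ⬝ᵥ y := sub_dotProduct _ _ _
    rcases le_or_gt (x - μ ⬝ᵥ y) 0 with h | h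
    · rw [max_eq_left h]
      simpa using hnn (μ - lam)
    · rw [max_eq_right h.le]
      generalize μ - lam = w at *
      have key := hnn (w + ((x - μ ⬝ᵥ y) / (y ⬝ᵥ z)) • z)
      simp only [Matrix.mulVec_add, Matrix.mulVec_smul, hVz, add_dotProduct, dotProduct_add,
        smul_dotProduct, dotProduct_smul, hsymm, hzy, smul_eq_mul] at key
      have hc : w ⬝ᵥ y ≤ -(x - μ ⬝ᵥ y) := by rw [hw]; linarith
      have ht : 0 < (x - μ ⬝ᵥ y) / (y ⬝ᵥ z) := div_pos h hq
      have e : (x - μ ⬝ᵥ y) / (y ⬝ᵥ z) * (y ⬝ᵥ z) = x - μ ⬝ᵥ y := div_mul_cancel₀ _ hq.ne'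
      have e2 : (x - μ ⬝ᵥ y) ^ 2 / (y ⬝ᵥ z)
          = (x - μ ⬝ᵥ y) / (y ⬝ᵥ z) * (x - μ ⬝ᵥ y) := by ring
      rw [e2]
      rw [e] at key
      have := mul_le_mul_of_nonneg_left hc ht.le
      linarith
end

section
/- Let V be a symmetric positive semidefinite d×d real matrix and let y ∈ ℝ^d be a vector that does not lie in the range of V (viewed as a linear map ℝ^d → ℝ^d). Then for every μ ∈ ℝ^d and every x ∈ ℝ, the infimum of (μ−λ)ᵀV(μ−λ) over {λ ∈ ℝ^d : ⟨λ, y⟩ ≥ x} equals 0, and it is attained: there exists λ ∈ ℝ^d with ⟨λ, y⟩ ≥ x and (μ−λ)ᵀV(μ−λ) = 0. -/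
open Matrix

lemma exists_ker_aux {d : ℕ} (V : Matrix (Fin d) (Fin d) ℝ) (hV : V.PosSemidef)
    (y : Fin d → ℝ) (hy : y ∉ Set.range V.mulVec) :
    ∃ z : Fin d → ℝ, V *ᵥ z = 0 ∧ z ⬝ᵥ y ≠ 0 := by
  by_contra! h
  apply hy
  have hmem : WithLp.toLp 2 y ∈ (V.toEuclideanLin.ker)ᗮ := by
    rw [Submodule.mem_orthogonal]
    intro u hu
    have hu' : V *ᵥ u.ofLp = 0 := by
      rw [LinearMap.mem_ker] at hu
      rw [← Matrix.ofLp_toEuclideanLin_apply, hu]; rfl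
    have := h _ hu'
    rw [EuclideanSpace.inner_eq_star_dotProduct]
    simpa [dotProduct_comm] using this
  rw [LinearMap.orthogonal_ker, ← Matrix.toEuclideanLin_conjTranspose_eq_adjoint,
    hV.isHermitian.eq] at hmem
  obtain ⟨w, hw⟩ := hmem
  refine ⟨w.ofLp, ?_⟩
  rw [← Matrix.ofLp_toEuclideanLin_apply, hw]

/-- For a symmetric positive semidefinite matrix `V` and a vector `y`
not in the range of `V`, for every `μ` and `x` the infimum of `(μ-λ)ᵀV(μ-λ)` over
`{λ | ⟨λ,y⟩ ≥ x}` equals `0` and is attained. -/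
theorem stmt1 {d : ℕ} (V : Matrix (Fin d) (Fin d) ℝ) (hV : V.PosSemidef)
    (y : Fin d → ℝ) (hy : y ∉ Set.range V.mulVec) (μ : Fin d → ℝ) (x : ℝ) :
    IsLeast ((fun lam => (μ - lam) ⬝ᵥ V.mulVec (μ - lam)) '' {lam | x ≤ lam ⬝ᵥ y}) 0 := by
  obtain ⟨z, hz, hzy⟩ := exists_ker_aux V hV y hy
  constructor
  · refine ⟨μ + ((x - μ ⬝ᵥ y) / (z ⬝ᵥ y)) • z, ?_, ?_⟩
    · simp only [Set.mem_setOf_eq, add_dotProduct, smul_dotProduct, smul_eq_mul]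
      rw [div_mul_cancel₀ _ hzy]
      linarith
    · simp [Matrix.mulVec_neg, Matrix.mulVec_smul, hz]
  · rintro _ ⟨lam, -, rfl⟩
    simpa using hV.dotProduct_mulVec_nonneg (μ - lam)
end

section
/- Let Z ⊆ ℝ^d be a finite set with at least two elements, let ε ≥ 0, let μ ∈ ℝ^d with z ∈ Z_ε(μ), and let V be a symmetric positive definite d×d real matrix. Then inf{ (μ−λ)ᵀV(μ−λ) : λ ∈ ¬_ε z } = min over x ∈ Z \ {z} of (ε + ⟨μ, z−x⟩)² / ((z−x)ᵀV⁻¹(z−x)), and for any x* attaining this minimum the infimum is attained at λ = μ − ((ε + ⟨μ, z−x*⟩)/((z−x*)ᵀV⁻¹(z−x*)))·V⁻¹(z−x*). -/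
open Matrix

noncomputable section

/-- The additive `ε`-optimal answers `Z_ε(μ)`. -/
def epsOpt {d : ℕ} (Z : Finset (Fin d → ℝ)) (ε : ℝ) (μ : Fin d → ℝ) :
    Set (Fin d → ℝ) :=
  {z | z ∈ Z ∧ ∀ x ∈ Z, μ ⬝ᵥ x - ε ≤ μ ⬝ᵥ z}

/-- The alternative `¬_ε z`: closure of the parameters for which `z` is not
`ε`-optimal (the parameter set is all of `ℝ^d`). -/
def altSet {d : ℕ} (Z : Finset (Fin d → ℝ)) (ε : ℝ) (z : Fin d → ℝ) :
    Set (Fin d → ℝ) :=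
  closure {lam | z ∉ epsOpt Z ε lam}

theorem aux_quad {d : ℕ} (V : Matrix (Fin d) (Fin d) ℝ) (hV : V.PosDef) (u w : Fin d → ℝ) (t : ℝ) :
    (u - t • V⁻¹.mulVec w) ⬝ᵥ V.mulVec (u - t • V⁻¹.mulVec w)
      = u ⬝ᵥ V.mulVec u - 2 * t * (u ⬝ᵥ w) + t ^ 2 * (w ⬝ᵥ V⁻¹.mulVec w) := by
  have hdet : IsUnit V.det := (Matrix.isUnit_iff_isUnit_det V).1 hV.isUnit
  have h1 : V.mulVec (V⁻¹.mulVec w) = w := by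
    rw [Matrix.mulVec_mulVec, Matrix.mul_nonsing_inv V hdet, Matrix.one_mulVec]
  have hT : Vᵀ = V := by
    have := hV.isHermitian.eq
    rwa [Matrix.conjTranspose_eq_transpose_of_trivial] at this
  have h2 : (V⁻¹.mulVec w) ⬝ᵥ V.mulVec u = u ⬝ᵥ w := by
    rw [Matrix.dotProduct_mulVec, ← Matrix.mulVec_transpose, hT, h1, dotProduct_comm]
  simp only [Matrix.mulVec_sub, Matrix.mulVec_smul, h1, sub_dotProduct, dotProduct_sub,
    smul_dotProduct, dotProduct_smul, smul_eq_mul, h2, dotProduct_comm (V⁻¹.mulVec w) w]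
  ring

theorem aux_q_pos {d : ℕ} (V : Matrix (Fin d) (Fin d) ℝ) (hV : V.PosDef) (w : Fin d → ℝ)
    (hw : w ≠ 0) : 0 < w ⬝ᵥ V⁻¹.mulVec w := by
  have := hV.inv.dotProduct_mulVec_pos hw
  simpa using this

theorem aux_cauchy {d : ℕ} (V : Matrix (Fin d) (Fin d) ℝ) (hV : V.PosDef) (u w : Fin d → ℝ)
    (hw : w ≠ 0) : (u ⬝ᵥ w) ^ 2 / (w ⬝ᵥ V⁻¹.mulVec w) ≤ u ⬝ᵥ V.mulVec u := by
  have hq := aux_q_pos V hV w hw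
  have h := aux_quad V hV u w ((u ⬝ᵥ w) / (w ⬝ᵥ V⁻¹.mulVec w))
  have h0 := hV.posSemidef.dotProduct_mulVec_nonneg
    (u - ((u ⬝ᵥ w) / (w ⬝ᵥ V⁻¹.mulVec w)) • V⁻¹.mulVec w)
  simp only [star_trivial] at h0
  rw [h] at h0
  have e : u ⬝ᵥ V.mulVec u - 2 * ((u ⬝ᵥ w) / (w ⬝ᵥ V⁻¹.mulVec w)) * (u ⬝ᵥ w)
      + ((u ⬝ᵥ w) / (w ⬝ᵥ V⁻¹.mulVec w)) ^ 2 * (w ⬝ᵥ V⁻¹.mulVec w)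
      = u ⬝ᵥ V.mulVec u - (u ⬝ᵥ w) ^ 2 / (w ⬝ᵥ V⁻¹.mulVec w) := by
    field_simp
    ring
  linarith

theorem aux_mem {d : ℕ} (Z : Finset (Fin d → ℝ)) (ε : ℝ) (μ z x : Fin d → ℝ)
    (V : Matrix (Fin d) (Fin d) ℝ) (hV : V.PosDef) (hx : x ∈ Z) (hw : z - x ≠ 0) :
    (μ - ((ε + μ ⬝ᵥ (z - x)) / ((z - x) ⬝ᵥ V⁻¹.mulVec (z - x))) •
            V⁻¹.mulVec (z - x)) ∈ altSet Z ε z := by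
  have hq := aux_q_pos V hV _ hw
  set q := (z - x) ⬝ᵥ V⁻¹.mulVec (z - x) with hqd
  set c := (ε + μ ⬝ᵥ (z - x)) / q with hc
  have hcq : c * q = ε + μ ⬝ᵥ (z - x) := by rw [hc]; field_simp
  have hcont : Continuous (fun t : ℝ => μ - (c + t) • V⁻¹.mulVec (z - x)) := by fun_prop
  have hlim : Filter.Tendsto (fun t : ℝ => μ - (c + t) • V⁻¹.mulVec (z - x))
      (nhdsWithin 0 (Set.Ioi 0)) (nhds (μ - c • V⁻¹.mulVec (z - x))) := by
    have := (hcont.tendsto 0).mono_left (nhdsWithin_le_nhds (s := Set.Ioi (0 : ℝ)))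
    simpa using this
  refine mem_closure_of_tendsto hlim ?_
  filter_upwards [self_mem_nhdsWithin] with t ht
  have ht : 0 < t := ht
  intro hmem
  have h := hmem.2 x hx
  have e : (μ - (c + t) • V⁻¹.mulVec (z - x)) ⬝ᵥ (z - x) = μ ⬝ᵥ (z - x) - (c + t) * q := by
    rw [sub_dotProduct, smul_dotProduct, smul_eq_mul, dotProduct_comm (V⁻¹.mulVec (z - x))]
  have e2 := dotProduct_sub (μ - (c + t) • V⁻¹.mulVec (z - x)) z x
  have : 0 < t * q := mul_pos ht hq
  linarith

theorem aux_val {d : ℕ} (ε : ℝ) (μ w : Fin d → ℝ)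
    (V : Matrix (Fin d) (Fin d) ℝ) (hV : V.PosDef) (hw : w ≠ 0) :
    (μ - (μ - ((ε + μ ⬝ᵥ w) / (w ⬝ᵥ V⁻¹.mulVec w)) • V⁻¹.mulVec w)) ⬝ᵥ
          V.mulVec (μ - (μ - ((ε + μ ⬝ᵥ w) / (w ⬝ᵥ V⁻¹.mulVec w)) • V⁻¹.mulVec w))
        = (ε + μ ⬝ᵥ w) ^ 2 / (w ⬝ᵥ V⁻¹.mulVec w) := by
  have hq := aux_q_pos V hV _ hw
  have h := aux_quad V hV 0 w (-((ε + μ ⬝ᵥ w) / (w ⬝ᵥ V⁻¹.mulVec w)))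
  rw [neg_smul, sub_neg_eq_add, zero_add] at h
  rw [sub_sub_cancel, h]
  simp only [zero_dotProduct]
  field_simp
  ring

/-- Explicit formula for the infimum of `‖μ-λ‖²_V` over the
additive alternative `¬_ε z`, together with the attaining alternative parameter. -/
theorem stmt2 {d : ℕ} (Z : Finset (Fin d → ℝ)) (hZ : 2 ≤ Z.card)
    (ε : ℝ) (hε : 0 ≤ ε) (μ : Fin d → ℝ)
    (z : Fin d → ℝ) (hz : z ∈ epsOpt Z ε μ)
    (V : Matrix (Fin d) (Fin d) ℝ) (hV : V.PosDef) :
    sInf ((fun lam => (μ - lam) ⬝ᵥ V.mulVec (μ - lam)) '' altSet Z ε z)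
      = sInf ((fun x => (ε + μ ⬝ᵥ (z - x)) ^ 2 / ((z - x) ⬝ᵥ V⁻¹.mulVec (z - x))) ''
          (Z.erase z : Set (Fin d → ℝ))) ∧
    ∀ xstar ∈ Z.erase z,
      (∀ x ∈ Z.erase z,
          (ε + μ ⬝ᵥ (z - xstar)) ^ 2 / ((z - xstar) ⬝ᵥ V⁻¹.mulVec (z - xstar))
            ≤ (ε + μ ⬝ᵥ (z - x)) ^ 2 / ((z - x) ⬝ᵥ V⁻¹.mulVec (z - x))) →
      (μ - ((ε + μ ⬝ᵥ (z - xstar)) / ((z - xstar) ⬝ᵥ V⁻¹.mulVec (z - xstar))) •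
            V⁻¹.mulVec (z - xstar)) ∈ altSet Z ε z ∧
      (μ - (μ - ((ε + μ ⬝ᵥ (z - xstar)) / ((z - xstar) ⬝ᵥ V⁻¹.mulVec (z - xstar))) •
            V⁻¹.mulVec (z - xstar))) ⬝ᵥ
          V.mulVec (μ - (μ - ((ε + μ ⬝ᵥ (z - xstar)) /
            ((z - xstar) ⬝ᵥ V⁻¹.mulVec (z - xstar))) • V⁻¹.mulVec (z - xstar)))
        = (ε + μ ⬝ᵥ (z - xstar)) ^ 2 / ((z - xstar) ⬝ᵥ V⁻¹.mulVec (z - xstar)) := by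
  have hne : ∀ x ∈ Z.erase z, z - x ≠ 0 := fun x hx h =>
    (Finset.mem_erase.1 hx).1 (sub_eq_zero.1 h).symm
  have hsecond : ∀ x ∈ Z.erase z, _ ∧ _ := fun x hx =>
    And.intro (aux_mem Z ε μ z x V hV (Finset.mem_of_mem_erase hx) (hne x hx))
      (aux_val ε μ (z - x) V hV (hne x hx))
  refine ⟨?_, fun x hx _ => hsecond x hx⟩
  have hnon : (Z.erase z).Nonempty := by
    rw [← Finset.card_pos, Finset.card_erase_of_mem hz.1]
    omega
  obtain ⟨s, hs, hmin⟩ := Finset.exists_min_image (Z.erase z)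
    (fun x => (ε + μ ⬝ᵥ (z - x)) ^ 2 / ((z - x) ⬝ᵥ V⁻¹.mulVec (z - x))) hnon
  have hR : IsLeast ((fun x => (ε + μ ⬝ᵥ (z - x)) ^ 2 / ((z - x) ⬝ᵥ V⁻¹.mulVec (z - x))) ''
          (Z.erase z : Set (Fin d → ℝ)))
      ((ε + μ ⬝ᵥ (z - s)) ^ 2 / ((z - s) ⬝ᵥ V⁻¹.mulVec (z - s))) := by
    refine ⟨⟨s, by exact_mod_cast hs, rfl⟩, ?_⟩
    rintro _ ⟨x, hx, rfl⟩
    exact hmin x (by exact_mod_cast hx)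
  have hL : IsLeast ((fun lam => (μ - lam) ⬝ᵥ V.mulVec (μ - lam)) '' altSet Z ε z)
      ((ε + μ ⬝ᵥ (z - s)) ^ 2 / ((z - s) ⬝ᵥ V⁻¹.mulVec (z - s))) := by
    refine ⟨⟨_, (hsecond s hs).1, (hsecond s hs).2⟩, ?_⟩
    rintro _ ⟨lam, hlam, rfl⟩
    have hcont : Continuous (fun lam : Fin d → ℝ => (μ - lam) ⬝ᵥ V.mulVec (μ - lam)) := by
      fun_prop
    refine closure_minimal ?_ (isClosed_le continuous_const hcont) hlam
    intro l hl
    have hl : ¬ (z ∈ Z ∧ ∀ x ∈ Z, l ⬝ᵥ x - ε ≤ l ⬝ᵥ z) := hl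
    push Not at hl
    obtain ⟨x, hx, hlx⟩ := hl hz.1
    have hxz : x ≠ z := by
      rintro rfl
      linarith
    have hxe : x ∈ Z.erase z := Finset.mem_erase.2 ⟨hxz, hx⟩
    have hq := aux_q_pos V hV _ (hne x hxe)
    refine (hmin x hxe).trans (le_trans ?_ (aux_cauchy V hV (μ - l) (z - x) (hne x hxe)))
    have hzx := hz.2 x hx
    have e1 := dotProduct_sub μ z x
    have e2 := dotProduct_sub l z x
    have e3 := sub_dotProduct μ l (z - x)
    have h0 : 0 ≤ ε + μ ⬝ᵥ (z - x) := by linarith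
    have h1 : ε + μ ⬝ᵥ (z - x) ≤ (μ - l) ⬝ᵥ (z - x) := by linarith
    gcongr
  rw [hR.csInf_eq, hL.csInf_eq]

end
end

section
/- Let Z ⊆ ℝ^d be a finite set with at least two elements, let ε ∈ [0,1), let μ ∈ ℝ^d with max_{x∈Z}⟨μ, x⟩ > 0, and let z ∈ Z satisfy ⟨μ, z⟩ ≥ (1−ε)·max_{x∈Z}⟨μ, x⟩. Assume z ≠ (1−ε)x for every x ∈ Z \ {z}, and let V be a symmetric positive definite d×d real matrix. Set A = ⋃_{x ∈ Z \ {z}} {λ ∈ ℝ^d : ⟨λ, z − (1−ε)x⟩ ≤ 0}. Then inf{ (μ−λ)ᵀV(μ−λ) : λ ∈ A } = min over x ∈ Z \ {z} of ⟨μ, z − (1−ε)x⟩² / ((z−(1−ε)x)ᵀV⁻¹(z−(1−ε)x)). -/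
open Matrix

lemma stmt3_aux {d : ℕ} (V : Matrix (Fin d) (Fin d) ℝ) (hV : V.PosDef) (μ y : Fin d → ℝ)
    (hy : y ≠ 0) (ha : 0 ≤ μ ⬝ᵥ y) :
    (∀ lam : Fin d → ℝ, lam ⬝ᵥ y ≤ 0 →
      (μ ⬝ᵥ y) ^ 2 / (y ⬝ᵥ V⁻¹.mulVec y) ≤ (μ - lam) ⬝ᵥ V.mulVec (μ - lam)) ∧
    ∃ lam : Fin d → ℝ, lam ⬝ᵥ y ≤ 0 ∧
      (μ - lam) ⬝ᵥ V.mulVec (μ - lam) = (μ ⬝ᵥ y) ^ 2 / (y ⬝ᵥ V⁻¹.mulVec y) := by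
  have hdet : IsUnit V.det := hV.det_pos.ne'.isUnit
  set u := V⁻¹.mulVec y with hu
  have hVu : V.mulVec u = y := by
    rw [hu, Matrix.mulVec_mulVec, Matrix.mul_nonsing_inv _ hdet, Matrix.one_mulVec]
  have hu0 : u ≠ 0 := by
    intro h
    rw [h, Matrix.mulVec_zero] at hVu
    exact hy hVu.symm
  have hq : 0 < y ⬝ᵥ u := by
    have := hV.dotProduct_mulVec_pos hu0
    rw [hVu] at this
    simpa [dotProduct_comm] using this
  have hsym : ∀ w : Fin d → ℝ, u ⬝ᵥ V.mulVec w = y ⬝ᵥ w := by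
    intro w
    have hT : Vᵀ = V := by simpa using hV.isHermitian.eq
    rw [Matrix.dotProduct_mulVec, ← Matrix.mulVec_transpose, hT, hVu]
  set a := μ ⬝ᵥ y with hadef
  set q := y ⬝ᵥ u with hqdef
  have huy : u ⬝ᵥ y = q := dotProduct_comm _ _
  refine ⟨?_, μ - (a / q) • u, ?_, ?_⟩
  · intro lam hl
    have h0 : 0 ≤ (μ - lam - (a / q) • u) ⬝ᵥ V.mulVec (μ - lam - (a / q) • u) := by
      simpa using hV.posSemidef.dotProduct_mulVec_nonneg (μ - lam - (a / q) • u)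
    set w := μ - lam with hw
    have hwy : w ⬝ᵥ y = a - lam ⬝ᵥ y := by rw [hw, sub_dotProduct]
    have hyw : y ⬝ᵥ w = w ⬝ᵥ y := dotProduct_comm _ _
    have h1 : (w - (a / q) • u) ⬝ᵥ V.mulVec (w - (a / q) • u)
        = w ⬝ᵥ V.mulVec w - 2 * (a / q) * (w ⬝ᵥ y) + (a / q) ^ 2 * q := by
      rw [Matrix.mulVec_sub, Matrix.mulVec_smul, hVu]
      simp only [sub_dotProduct, dotProduct_sub, smul_dotProduct, dotProduct_smul, hsym,
        smul_eq_mul, huy, hyw]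
      ring
    rw [h1, hwy] at h0
    have ht : 0 ≤ a / q := div_nonneg ha hq.le
    have h2 : (a / q) ^ 2 * q = a ^ 2 / q := by field_simp
    have h3 : a / q * a = a ^ 2 / q := by field_simp
    have h4 : (a / q) * (lam ⬝ᵥ y) ≤ 0 := mul_nonpos_of_nonneg_of_nonpos ht hl
    nlinarith
  · rw [sub_dotProduct, smul_dotProduct, huy, smul_eq_mul, ← hadef, div_mul_cancel₀ _ hq.ne']
    simp
  · rw [sub_sub_cancel, Matrix.mulVec_smul, hVu, smul_dotProduct, dotProduct_smul, huy]
    simp only [smul_eq_mul]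
    field_simp

/-- Explicit formula for the infimum of `‖μ-λ‖²_V` over the
multiplicative alternative, written as a union of closed half-spaces. -/
theorem stmt3 {d : ℕ} (Z : Finset (Fin d → ℝ)) (hZcard : 2 ≤ Z.card)
    (ε : ℝ) (hε0 : 0 ≤ ε) (hε1 : ε < 1) (μ : Fin d → ℝ) (hne : Z.Nonempty)
    (hmax : 0 < Z.sup' hne (fun x => μ ⬝ᵥ x))
    (z : Fin d → ℝ) (hzZ : z ∈ Z)
    (hzopt : (1 - ε) * Z.sup' hne (fun x => μ ⬝ᵥ x) ≤ μ ⬝ᵥ z)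
    (hzx : ∀ x ∈ Z.erase z, z ≠ (1 - ε) • x)
    (V : Matrix (Fin d) (Fin d) ℝ) (hV : V.PosDef) :
    sInf ((fun lam => (μ - lam) ⬝ᵥ V.mulVec (μ - lam)) ''
        (⋃ x ∈ Z.erase z, {lam : Fin d → ℝ | lam ⬝ᵥ (z - (1 - ε) • x) ≤ 0}))
      = sInf ((fun x => (μ ⬝ᵥ (z - (1 - ε) • x)) ^ 2 /
            ((z - (1 - ε) • x) ⬝ᵥ V⁻¹.mulVec (z - (1 - ε) • x))) ''
          (Z.erase z : Set (Fin d → ℝ))) := by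
  have hy : ∀ x ∈ Z.erase z, z - (1 - ε) • x ≠ 0 := fun x hx => sub_ne_zero.mpr (hzx x hx)
  have ha : ∀ x ∈ Z.erase z, 0 ≤ μ ⬝ᵥ (z - (1 - ε) • x) := by
    intro x hx
    have h1 : μ ⬝ᵥ x ≤ Z.sup' hne (fun x => μ ⬝ᵥ x) :=
      Finset.le_sup' (fun x => μ ⬝ᵥ x) (Finset.mem_of_mem_erase hx)
    have h2 := mul_le_mul_of_nonneg_left h1 (sub_nonneg.mpr hε1.le)
    rw [dotProduct_sub, dotProduct_smul, smul_eq_mul]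
    linarith
  have hnz : (Z.erase z).Nonempty := by
    rw [← Finset.card_pos, Finset.card_erase_of_mem hzZ]
    omega
  obtain ⟨x0, hx0⟩ := hnz
  apply le_antisymm
  · apply le_csInf
    · exact ⟨_, x0, Finset.mem_coe.mpr hx0, rfl⟩
    · rintro _ ⟨x, hx, rfl⟩
      have hx := Finset.mem_coe.mp hx
      obtain ⟨-, lam, hl, he⟩ := stmt3_aux V hV μ _ (hy x hx) (ha x hx)
      apply csInf_le
      · refine ⟨0, ?_⟩
        rintro _ ⟨l, -, rfl⟩
        simpa using hV.posSemidef.dotProduct_mulVec_nonneg (μ - l)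
      · exact ⟨lam, Set.mem_iUnion₂.mpr ⟨x, hx, hl⟩, he⟩
  · apply le_csInf
    · obtain ⟨-, lam, hl, -⟩ := stmt3_aux V hV μ _ (hy x0 hx0) (ha x0 hx0)
      exact ⟨_, lam, Set.mem_iUnion₂.mpr ⟨x0, hx0, hl⟩, rfl⟩
    · rintro _ ⟨lam, hlam, rfl⟩
      obtain ⟨x, hx, hl⟩ := Set.mem_iUnion₂.mp hlam
      refine le_trans (csInf_le ?_ ⟨x, Finset.mem_coe.mpr hx, rfl⟩)
        ((stmt3_aux V hV μ _ (hy x hx) (ha x hx)).1 lam hl)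
      exact (Set.Finite.image _ (Finset.finite_toSet _)).bddBelow
end

section
/- Let K ⊆ ℝ^d be a finite set spanning ℝ^d, let Z ⊆ ℝ^d be a finite nonempty set, let ε ≥ 0, and let μ ∈ ℝ^d. Assume ¬_ε z is nonempty for every z ∈ Z, and assume the furthest-answer set z_F(μ) is a singleton. Then there exists Δ > 0 such that every λ ∈ ℝ^d with z_F(λ) ≠ z_F(μ) satisfies max over a ∈ K of ⟨μ−λ, a⟩² ≥ Δ. -/
open Matrix

noncomputable section

/-- The design matrix `V_w = ∑_{a∈K} w(a)·a aᵀ`. -/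
def designMat {d : ℕ} (K : Finset (Fin d → ℝ)) (w : (Fin d → ℝ) → ℝ) :
    Matrix (Fin d) (Fin d) ℝ :=
  ∑ a ∈ K, w a • vecMulVec a a

/-- The probability simplex `Δ_K` over the arms `K`. -/
def simplexK {d : ℕ} (K : Finset (Fin d → ℝ)) : Set ((Fin d → ℝ) → ℝ) :=
  {w | (∀ a, 0 ≤ w a) ∧ ∑ a ∈ K, w a = 1}

/-- `g_μ(z) = sup_{w∈Δ_K} inf_{λ∈¬_ε z} (1/2)‖μ-λ‖²_{V_w}`. -/
def gval {d : ℕ} (K Z : Finset (Fin d → ℝ)) (ε : ℝ) (μ z : Fin d → ℝ) : ℝ :=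
  sSup ((fun w =>
      sInf ((fun lam => (1 / 2) * ((μ - lam) ⬝ᵥ (designMat K w).mulVec (μ - lam))) ''
        altSet Z ε z)) '' simplexK K)

/-- The furthest answers `z_F(μ)`: maximizers of `g_μ` over `Z_ε(μ)`. -/
def zF {d : ℕ} (K Z : Finset (Fin d → ℝ)) (ε : ℝ) (μ : Fin d → ℝ) :
    Set (Fin d → ℝ) :=
  {z ∈ epsOpt Z ε μ | ∀ z' ∈ epsOpt Z ε μ, gval K Z ε μ z' ≤ gval K Z ε μ z}

/-- The quadratic form in coordinates. -/
lemma quad_eq {d : ℕ} (K : Finset (Fin d → ℝ)) (w : (Fin d → ℝ) → ℝ) (x : Fin d → ℝ) :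
    x ⬝ᵥ (designMat K w).mulVec x = ∑ a ∈ K, w a * (x ⬝ᵥ a) ^ 2 := by
  unfold designMat
  rw [Matrix.sum_mulVec, dotProduct_sum]
  refine Finset.sum_congr rfl fun a _ => ?_
  rw [Matrix.smul_mulVec, dotProduct_smul, Matrix.vecMulVec_mulVec]
  simp [dotProduct_smul, dotProduct_comm a x]
  left
  ring

/-- A bound on half the squared design seminorm. -/
def Dbd {d : ℕ} (K : Finset (Fin d → ℝ)) (x : Fin d → ℝ) : ℝ :=
  (1 / 2) * ∑ a ∈ K, (x ⬝ᵥ a) ^ 2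

/-- Half the squared design seminorm. -/
def Qf {d : ℕ} (K : Finset (Fin d → ℝ)) (w : (Fin d → ℝ) → ℝ) (x : Fin d → ℝ) : ℝ :=
  (1 / 2) * (x ⬝ᵥ (designMat K w).mulVec x)

lemma Qf_eq {d : ℕ} (K : Finset (Fin d → ℝ)) (w : (Fin d → ℝ) → ℝ) (x : Fin d → ℝ) :
    Qf K w x = (1 / 2) * ∑ a ∈ K, w a * (x ⬝ᵥ a) ^ 2 := by
  rw [Qf, quad_eq]

lemma Dbd_nonneg {d : ℕ} (K : Finset (Fin d → ℝ)) (x : Fin d → ℝ) : 0 ≤ Dbd K x := by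
  unfold Dbd
  positivity

lemma Qf_nonneg {d : ℕ} {K : Finset (Fin d → ℝ)} {w : (Fin d → ℝ) → ℝ}
    (hw : w ∈ simplexK K) (x : Fin d → ℝ) : 0 ≤ Qf K w x := by
  rw [Qf_eq]
  have : 0 ≤ ∑ a ∈ K, w a * (x ⬝ᵥ a) ^ 2 :=
    Finset.sum_nonneg fun a _ => mul_nonneg (hw.1 a) (sq_nonneg _)
  linarith

lemma Qf_le {d : ℕ} {K : Finset (Fin d → ℝ)} {w : (Fin d → ℝ) → ℝ}
    (hw : w ∈ simplexK K) (x : Fin d → ℝ) : Qf K w x ≤ Dbd K x := by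
  rw [Qf_eq, Dbd]
  have : ∑ a ∈ K, w a * (x ⬝ᵥ a) ^ 2 ≤ ∑ a ∈ K, (x ⬝ᵥ a) ^ 2 := by
    refine Finset.sum_le_sum fun a ha => ?_
    have h1 : w a ≤ 1 := by
      rw [← hw.2]
      exact Finset.single_le_sum (fun b _ => hw.1 b) ha
    exact mul_le_of_le_one_left (sq_nonneg _) h1
  linarith

lemma Qf_add {d : ℕ} {K : Finset (Fin d → ℝ)} {w : (Fin d → ℝ) → ℝ}
    (hw : w ∈ simplexK K) {t : ℝ} (ht : 0 < t) (x y : Fin d → ℝ) :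
    Qf K w (x + y) ≤ (1 + t) * Qf K w x + (1 + 1 / t) * Qf K w y := by
  have : ∑ a ∈ K, w a * ((x + y) ⬝ᵥ a) ^ 2 ≤
      (1 + t) * ∑ a ∈ K, w a * (x ⬝ᵥ a) ^ 2 + (1 + 1 / t) * ∑ a ∈ K, w a * (y ⬝ᵥ a) ^ 2 := by
    rw [Finset.mul_sum, Finset.mul_sum, ← Finset.sum_add_distrib]
    refine Finset.sum_le_sum fun a _ => ?_
    rw [add_dotProduct]
    generalize x ⬝ᵥ a = p
    generalize y ⬝ᵥ a = q
    have h : (p + q) ^ 2 ≤ (1 + t) * p ^ 2 + (1 + 1 / t) * q ^ 2 := by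
      have h2 : (1 + t) * p ^ 2 + (1 + 1 / t) * q ^ 2 - (p + q) ^ 2 = (t * p - q) ^ 2 / t := by
        field_simp
        ring
      have h3 : 0 ≤ (t * p - q) ^ 2 / t := by positivity
      linarith
    have := mul_le_mul_of_nonneg_left h (hw.1 a)
    linarith
  rw [Qf_eq, Qf_eq, Qf_eq]
  linarith

/-- The inner infimum. -/
def innerInf {d : ℕ} (K Z : Finset (Fin d → ℝ)) (ε : ℝ) (μ z : Fin d → ℝ)
    (w : (Fin d → ℝ) → ℝ) : ℝ :=
  sInf ((fun lam => Qf K w (μ - lam)) '' altSet Z ε z)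

lemma gval_eq {d : ℕ} (K Z : Finset (Fin d → ℝ)) (ε : ℝ) (μ z : Fin d → ℝ) :
    gval K Z ε μ z = sSup (innerInf K Z ε μ z '' simplexK K) := rfl

lemma innerInf_le {d : ℕ} {K Z : Finset (Fin d → ℝ)} {ε : ℝ} {μ z : Fin d → ℝ}
    {w : (Fin d → ℝ) → ℝ} (hw : w ∈ simplexK K) {l : Fin d → ℝ} (hl : l ∈ altSet Z ε z) :
    innerInf K Z ε μ z w ≤ Qf K w (μ - l) := by
  refine csInf_le ⟨0, ?_⟩ ⟨l, hl, rfl⟩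
  rintro _ ⟨l', _, rfl⟩
  exact Qf_nonneg hw _

lemma innerInf_nonneg {d : ℕ} {K Z : Finset (Fin d → ℝ)} {ε : ℝ} {μ z : Fin d → ℝ}
    {w : (Fin d → ℝ) → ℝ} (hw : w ∈ simplexK K) : 0 ≤ innerInf K Z ε μ z w := by
  refine Real.sInf_nonneg ?_
  rintro _ ⟨l', _, rfl⟩
  exact Qf_nonneg hw _

lemma gval_nonneg {d : ℕ} (K Z : Finset (Fin d → ℝ)) (ε : ℝ) (μ z : Fin d → ℝ) :
    0 ≤ gval K Z ε μ z := by
  rw [gval_eq]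
  refine Real.sSup_nonneg ?_
  rintro _ ⟨w, hw, rfl⟩
  exact innerInf_nonneg hw

lemma innerInf_le_gval {d : ℕ} {K Z : Finset (Fin d → ℝ)} {ε : ℝ} {μ z : Fin d → ℝ}
    (hz : (altSet Z ε z).Nonempty)
    {w : (Fin d → ℝ) → ℝ} (hw : w ∈ simplexK K) :
    innerInf K Z ε μ z w ≤ gval K Z ε μ z := by
  rw [gval_eq]
  obtain ⟨l, hl⟩ := hz
  refine le_csSup ⟨Dbd K (μ - l), ?_⟩ ⟨w, hw, rfl⟩
  rintro _ ⟨w', hw', rfl⟩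
  exact (innerInf_le hw' hl).trans (Qf_le hw' _)

lemma gval_eq_zero {d : ℕ} {K Z : Finset (Fin d → ℝ)} {ε : ℝ} {μ z : Fin d → ℝ}
    (h : μ ∈ altSet Z ε z) : gval K Z ε μ z = 0 := by
  refine le_antisymm ?_ (gval_nonneg _ _ _ _ _)
  rw [gval_eq]
  refine Real.sSup_le ?_ le_rfl
  rintro _ ⟨w, hw, rfl⟩
  refine (innerInf_le hw h).trans ?_
  simp [Qf]

lemma gval_compare {d : ℕ} {K Z : Finset (Fin d → ℝ)} {ε : ℝ} {z : Fin d → ℝ}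
    (hz : (altSet Z ε z).Nonempty) (μ lam : Fin d → ℝ) {t : ℝ} (ht : 0 < t) :
    gval K Z ε lam z ≤ (1 + t) * gval K Z ε μ z + (1 + 1 / t) * Dbd K (lam - μ) := by
  have hD := Dbd_nonneg K (lam - μ)
  have hg := gval_nonneg K Z ε μ z
  rw [gval_eq K Z ε lam]
  refine Real.sSup_le ?_ (by positivity)
  rintro _ ⟨w, hw, rfl⟩
  have h1 : (innerInf K Z ε lam z w - (1 + 1 / t) * Dbd K (lam - μ)) / (1 + t) ≤
      innerInf K Z ε μ z w := by
    refine le_csInf (hz.image _) ?_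
    rintro _ ⟨l, hl, rfl⟩
    have h2 := innerInf_le (μ := lam) hw hl
    have h3 := Qf_add hw ht (μ - l) (lam - μ)
    rw [show μ - l + (lam - μ) = lam - l by abel] at h3
    have h4 := mul_le_mul_of_nonneg_left (Qf_le hw (lam - μ))
      (show 0 ≤ 1 + 1 / t by positivity)
    rw [div_le_iff₀ (by positivity)]
    change _ ≤ Qf K w (μ - l) * (1 + t)
    linarith
  have h5 := h1.trans (innerInf_le_gval hz hw)
  rw [div_le_iff₀ (by positivity)] at h5
  linarith

lemma Dbd_neg {d : ℕ} (K : Finset (Fin d → ℝ)) (x y : Fin d → ℝ) :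
    Dbd K (x - y) = Dbd K (y - x) := by
  unfold Dbd
  congr 1
  refine Finset.sum_congr rfl fun a _ => ?_
  rw [← neg_sub y x, neg_dotProduct, neg_sq]

open Filter Topology in
lemma gval_lt_eventually {d : ℕ} {K Z : Finset (Fin d → ℝ)} {ε : ℝ} {z z' μ : Fin d → ℝ}
    (hz : (altSet Z ε z).Nonempty) (hz' : (altSet Z ε z').Nonempty)
    (hlt : gval K Z ε μ z' < gval K Z ε μ z) :
    ∀ᶠ lam in 𝓝 μ, gval K Z ε lam z' < gval K Z ε lam z := by
  obtain ⟨t, ht, h1⟩ : ∃ t : ℝ, 0 < t ∧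
      (1 + t) * ((1 + t) * gval K Z ε μ z') < gval K Z ε μ z := by
    have hc : Continuous fun t : ℝ => (1 + t) * ((1 + t) * gval K Z ε μ z') := by fun_prop
    have h0 : ∀ᶠ t in 𝓝 (0 : ℝ), (1 + t) * ((1 + t) * gval K Z ε μ z') < gval K Z ε μ z :=
      hc.continuousAt.eventually_lt continuousAt_const (by simpa using hlt)
    have h2 : ∀ᶠ t in 𝓝[>] (0 : ℝ), (1 + t) * ((1 + t) * gval K Z ε μ z') < gval K Z ε μ z :=
      h0.filter_mono nhdsWithin_le_nhds
    obtain ⟨t, ht1, ht2⟩ := (h2.and self_mem_nhdsWithin).exists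
    exact ⟨t, ht2, ht1⟩
  have hc : Continuous fun lam : Fin d → ℝ =>
      (1 + t) * ((1 + t) * gval K Z ε μ z' + (1 + 1 / t) * Dbd K (lam - μ))
        + (1 + 1 / t) * Dbd K (lam - μ) := by
    unfold Dbd dotProduct
    fun_prop
  have h3 := hc.continuousAt.eventually_lt (x₀ := μ)
    (g := fun _ => gval K Z ε μ z) continuousAt_const (by simpa [Dbd] using h1)
  filter_upwards [h3] with lam h4
  have h5 := gval_compare (K := K) hz' μ lam ht
  have h6 := gval_compare (K := K) hz lam μ ht
  rw [Dbd_neg] at h6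
  by_contra! hcon
  have h7 := mul_le_mul_of_nonneg_left (hcon.trans h5) (show 0 ≤ 1 + t by positivity)
  linarith

open Filter Topology in
lemma zF_eventually {d : ℕ} (K Z : Finset (Fin d → ℝ)) (hZ : Z.Nonempty)
    (ε : ℝ) (hε : 0 ≤ ε) (μ : Fin d → ℝ)
    (halt : ∀ z ∈ Z, (altSet Z ε z).Nonempty) (z₀ : Fin d → ℝ)
    (hsing : zF K Z ε μ = {z₀}) :
    ∀ᶠ lam in 𝓝 μ, zF K Z ε lam = {z₀} := by
  have hz₀ : z₀ ∈ zF K Z ε μ := by rw [hsing]; rfl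
  have hne : ∀ lam, (epsOpt Z ε lam).Nonempty := by
    intro lam
    obtain ⟨z, hz, hmax⟩ := Z.exists_max_image (fun z => lam ⬝ᵥ z) hZ
    exact ⟨z, hz, fun x hx => by linarith [hmax x hx]⟩
  have hsub : ∀ᶠ lam in 𝓝 μ, ∀ z ∈ Z, z ∈ epsOpt Z ε lam → z ∈ epsOpt Z ε μ := by
    rw [Filter.eventually_all_finset]
    intro z hz
    by_cases h : z ∈ epsOpt Z ε μ
    · exact Eventually.of_forall fun _ _ => h
    · have : ∃ x ∈ Z, μ ⬝ᵥ z < μ ⬝ᵥ x - ε := by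
        by_contra! hc
        exact h ⟨hz, hc⟩
      obtain ⟨x, hx, hlt⟩ := this
      have hc1 : Continuous fun lam : Fin d → ℝ => lam ⬝ᵥ z := by unfold dotProduct; fun_prop
      have hc2 : Continuous fun lam : Fin d → ℝ => lam ⬝ᵥ x - ε := by
        unfold dotProduct; fun_prop
      filter_upwards [hc1.continuousAt.eventually_lt hc2.continuousAt hlt] with lam hl hm
      exact absurd (hm.2 x hx) (not_le.mpr hl)
  have hstrict : ∀ z ∈ epsOpt Z ε μ, z ≠ z₀ → gval K Z ε μ z < gval K Z ε μ z₀ := by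
    intro z hz hzne
    by_contra! hcon
    have : z ∈ zF K Z ε μ := ⟨hz, fun z' hz' => (hz₀.2 z' hz').trans hcon⟩
    rw [hsing] at this
    exact hzne this
  have hg : ∀ᶠ lam in 𝓝 μ, ∀ z ∈ Z, z ∈ epsOpt Z ε μ → z ≠ z₀ →
      gval K Z ε lam z < gval K Z ε lam z₀ := by
    rw [Filter.eventually_all_finset]
    intro z hz
    by_cases h : z ∈ epsOpt Z ε μ ∧ z ≠ z₀
    · filter_upwards [gval_lt_eventually (halt z₀ hz₀.1.1) (halt z hz) (hstrict z h.1 h.2)]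
        with lam hl _ _ using hl
    · exact Eventually.of_forall fun _ h1 h2 => absurd ⟨h1, h2⟩ h
  have hmem : ∀ᶠ lam in 𝓝 μ, z₀ ∈ epsOpt Z ε lam := by
    by_cases h : ∃ z ∈ epsOpt Z ε μ, z ≠ z₀
    · obtain ⟨z, hz, hzne⟩ := h
      have hpos := (gval_nonneg K Z ε μ z).trans_lt (hstrict z hz hzne)
      have hnot : μ ∉ altSet Z ε z₀ := fun hm => hpos.ne' (gval_eq_zero hm)
      have hop : IsOpen (altSet Z ε z₀)ᶜ := isClosed_closure.isOpen_compl
      filter_upwards [hop.mem_nhds hnot] with lam hl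
      by_contra hcon
      exact hl (subset_closure hcon)
    · push Not at h
      filter_upwards [hsub] with lam hl
      obtain ⟨z, hz⟩ := hne lam
      have := h z (hl z hz.1 hz)
      rwa [this] at hz
  filter_upwards [hsub, hg, hmem] with lam h1 h2 h3
  ext z
  rw [Set.mem_singleton_iff]
  constructor
  · intro hz
    by_contra hzne
    exact absurd (hz.2 z₀ h3) (not_le.mpr (h2 z hz.1.1 (h1 z hz.1.1 hz.1) hzne))
  · rintro rfl
    refine ⟨h3, fun z' hz' => ?_⟩
    by_cases hzz : z' = z
    · rw [hzz]
    · exact (h2 z' hz'.1 (h1 z' hz'.1 hz') hzz).le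

/-- Evaluation of the arms. -/
def armMap {d : ℕ} (K : Finset (Fin d → ℝ)) : (Fin d → ℝ) →ₗ[ℝ] (K → ℝ) where
  toFun x := fun a => x ⬝ᵥ a.1
  map_add' x y := by ext a; simp [add_dotProduct]
  map_smul' c x := by ext a; simp [smul_dotProduct]

lemma armMap_ker {d : ℕ} (K : Finset (Fin d → ℝ))
    (hspan : Submodule.span ℝ (K : Set (Fin d → ℝ)) = ⊤) : LinearMap.ker (armMap K) = ⊥ := by
  rw [LinearMap.ker_eq_bot']
  intro x hx
  have h : ∀ y ∈ Submodule.span ℝ (K : Set (Fin d → ℝ)), x ⬝ᵥ y = 0 := by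
    intro y hy
    induction hy using Submodule.span_induction with
    | mem a ha => exact congrFun hx ⟨a, ha⟩
    | zero => simp
    | add a b _ _ h1 h2 => rw [dotProduct_add, h1, h2, add_zero]
    | smul c a _ h1 => rw [dotProduct_smul, h1, smul_zero]
  rw [hspan] at h
  exact dotProduct_self_eq_zero.mp (h x trivial)

/-- If the furthest-answer set at `μ` is a singleton, then there is
`Δ > 0` such that every `λ` with `z_F(λ) ≠ z_F(μ)` satisfies
`max_{a∈K} ⟨μ-λ, a⟩² ≥ Δ`. -/
theorem stmt10 {d : ℕ} (K Z : Finset (Fin d → ℝ)) (hZ : Z.Nonempty)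
    (hspan : Submodule.span ℝ (K : Set (Fin d → ℝ)) = ⊤)
    (ε : ℝ) (hε : 0 ≤ ε) (μ : Fin d → ℝ)
    (halt : ∀ z ∈ Z, (altSet Z ε z).Nonempty)
    (hsing : ∃ z₀, zF K Z ε μ = {z₀}) :
    ∃ Δ : ℝ, 0 < Δ ∧ ∀ lam : Fin d → ℝ, zF K Z ε lam ≠ zF K Z ε μ →
      ∃ a ∈ K, Δ ≤ ((μ - lam) ⬝ᵥ a) ^ 2 := by
  obtain ⟨z₀, hz₀⟩ := hsing
  have hev := zF_eventually K Z hZ ε hε μ halt z₀ hz₀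
  obtain ⟨r, hr, hball⟩ := Metric.eventually_nhds_iff.mp hev
  obtain ⟨c, hc, hanti⟩ := (armMap K).exists_antilipschitzWith (armMap_ker K hspan)
  have hc' : (0 : ℝ) < c := hc
  refine ⟨(r / c) ^ 2, by positivity, fun lam hlam => ?_⟩
  by_contra! hcon
  apply hlam
  rw [hz₀]
  apply hball
  rw [dist_comm]
  have hd : dist (armMap K μ) (armMap K lam) < r / c := by
    rw [dist_pi_lt_iff (by positivity)]
    intro a
    have h1 := abs_lt_of_sq_lt_sq (hcon a.1 a.2) (by positivity)
    rw [sub_dotProduct] at h1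
    exact h1
  have h2 := hanti.le_mul_dist μ lam
  rw [lt_div_iff₀ hc'] at hd
  linarith

end
end

section
/- Let K ⊆ ℝ^d be a finite set, let N : K → [0,∞), and suppose the matrix V_N = ∑_{b∈K} N(b)·b bᵀ is invertible. Then for every a ∈ K with N(a) > 0, one has aᵀ V_N⁻¹ a ≤ 1/N(a). -/
open Matrix

/-- For an invertible design matrix `V_N = ∑_{b∈K} N(b)·b bᵀ` with
nonnegative weights, every arm `a ∈ K` with `N(a) > 0` satisfies
`aᵀ V_N⁻¹ a ≤ 1/N(a)`. -/
theorem stmt12 {d : ℕ} (K : Finset (Fin d → ℝ)) (N : (Fin d → ℝ) → ℝ)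
    (hN : ∀ a ∈ K, 0 ≤ N a)
    (hV : IsUnit (∑ b ∈ K, N b • vecMulVec b b)) :
    ∀ a ∈ K, 0 < N a →
      a ⬝ᵥ (∑ b ∈ K, N b • vecMulVec b b)⁻¹.mulVec a ≤ 1 / N a := by
  intro a ha hpos
  have key : ∀ x : Fin d → ℝ, x ⬝ᵥ (∑ b ∈ K, N b • vecMulVec b b).mulVec x
      = ∑ b ∈ K, N b * (b ⬝ᵥ x) ^ 2 := by
    intro x
    rw [Matrix.sum_mulVec, dotProduct_sum]
    refine Finset.sum_congr rfl fun b _ => ?_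
    rw [smul_mulVec, vecMulVec_mulVec, dotProduct_smul, dotProduct_smul, dotProduct_comm x b]
    simp [pow_two]
  have h := key ((∑ b ∈ K, N b • vecMulVec b b)⁻¹.mulVec a)
  rw [mulVec_mulVec, Matrix.mul_nonsing_inv _ ((Matrix.isUnit_iff_isUnit_det _).1 hV),
    one_mulVec, dotProduct_comm] at h
  have h2 := Finset.single_le_sum (f := fun b => N b *
    (b ⬝ᵥ (∑ b ∈ K, N b • vecMulVec b b)⁻¹.mulVec a) ^ 2)
    (fun b hb => mul_nonneg (hN b hb) (sq_nonneg _)) ha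
  rw [← h] at h2
  generalize a ⬝ᵥ (∑ b ∈ K, N b • vecMulVec b b)⁻¹.mulVec a = s at h2
  rw [le_div_iff₀ hpos]
  by_contra! hc
  have hs : 0 < s := by
    by_contra! hs
    nlinarith
  nlinarith
end
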